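/- Let p be a prime, and let B be a finite left brace with additive group isomorphic to Z/(p^{α₁}) × ⋯ × Z/(p^{α_m}) where 1 ≤ α₁ ≤ ⋯ ≤ α_m. If m + 2 ≤ p, then for every x ∈ B the multiplicative order of x equals the additive order of x. -/

import Mathlib

open Polynomial in
/-- `1 + (X+1) + ⋯ + (X+1)^(p-1) = X^(p-1) + p (1 + X h)`. -/
theorem aux_poly (p : ℕ) (hp : p.Prime) :
    ∃ h : ℤ[X], ∑ i ∈ Finset.range p, (X + 1 : ℤ[X]) ^ i
      = X ^ (p - 1) + (p : ℤ[X]) * (1 + X * h) := by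
  obtain ⟨r, hr⟩ := exists_add_pow_prime_eq hp (X : ℤ[X]) 1
  have h1 : p - 1 + 1 = p := Nat.sub_add_cancel hp.one_le
  have hS : ∑ i ∈ Finset.range p, (X + 1 : ℤ[X]) ^ i = X ^ (p - 1) + (p : ℤ[X]) * r := by
    have h2 := mul_geom_sum (X + 1 : ℤ[X]) p
    apply mul_left_cancel₀ (X_ne_zero : (X : ℤ[X]) ≠ 0)
    have h3 : (X : ℤ[X]) ^ p = X * X ^ (p - 1) := by rw [← pow_succ', h1]
    rw [add_sub_cancel_right, hr] at h2
    rw [h2, h3]; ring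
  have h0 := congrArg (eval 0) hS
  have hp1 : p - 1 ≠ 0 := by have := hp.two_le; omega
  have hp0 : (p : ℤ) ≠ 0 := by exact_mod_cast hp.ne_zero
  simp [eval_finsetSum, hp1] at h0
  have hr0 : r.eval 0 = 1 := by
    have : (p : ℤ) * r.eval 0 = p * 1 := by
      simpa using h0.symm
    exact mul_left_cancel₀ hp0 this
  have hd : (X : ℤ[X]) ∣ r - 1 := by
    rw [X_dvd_iff, coeff_zero_eq_eval_zero]; simp [hr0]
  obtain ⟨h, hh⟩ := hd
  refine ⟨h, ?_⟩
  rw [hS, ← hh]; ring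

/-- A nilpotent endomorphism of an `F_p`-vector space with at most `p^m` elements. -/
theorem aux_elem0 (p m : ℕ) [Fact p.Prime] (V : Type*) [AddCommGroup V] [Fintype V]
    [Module (ZMod p) V] (N : Module.End ℤ V) (hN : IsNilpotent N)
    (hc : Nat.card V ≤ p ^ m) (v : V) : (N ^ m) v = 0 := by
  have hp : p.Prime := Fact.out
  let F : V →ₗ[ZMod p] V := AddMonoidHom.toZModLinearMap p N.toAddMonoidHom
  have hF : ∀ w : V, F w = N w := fun w => rfl
  have hFk : ∀ (k : ℕ) (w : V), ((F : Module.End (ZMod p) V) ^ k) w = (N ^ k) w := by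
    intro k
    induction k with
    | zero => intro w; rfl
    | succ k ih =>
      intro w
      rw [pow_succ, pow_succ, Module.End.mul_apply, Module.End.mul_apply, hF, ih]
  have hfin : Module.finrank (ZMod p) V ≤ m := by
    have c7 := Module.card_eq_pow_finrank (K := ZMod p) (V := V)
    rw [ZMod.card, ← Nat.card_eq_fintype_card] at c7
    rw [c7] at hc
    exact (Nat.pow_le_pow_iff_right hp.one_lt).1 hc
  obtain ⟨k, hk⟩ := hN
  have hmem : v ∈ LinearMap.ker ((F : Module.End (ZMod p) V) ^ (m + k)) := by
    rw [LinearMap.mem_ker, hFk, pow_add, hk]; simp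
  rw [Module.End.ker_pow_eq_ker_pow_finrank_of_le (by omega),
    ← Module.End.ker_pow_eq_ker_pow_finrank_of_le hfin, LinearMap.mem_ker, hFk] at hmem
  exact hmem

/-- A nilpotent endomorphism of an elementary abelian `p`-group with at most `p^m` elements. -/
theorem aux_elem (p m : ℕ) (hp : p.Prime) (V : Type*) [AddCommGroup V] [Finite V]
    (hV : ∀ q : V, p • q = 0) (N : Module.End ℤ V) (hN : IsNilpotent N)
    (hc : Nat.card V ≤ p ^ m) (v : V) : (N ^ m) v = 0 :=
  @aux_elem0 p m ⟨hp⟩ V _ (Fintype.ofFinite V) (AddCommGroup.zmodModule hV) N hN hc v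

/-- A nilpotent endomorphism of a finite abelian group with at most `p^m` elements killed by `p`. -/
theorem aux_nilp (p m : ℕ) (hp : p.Prime) (W : Type*) [AddCommGroup W] [Finite W]
    (N : Module.End ℤ W) (hN : IsNilpotent N)
    (hc : Nat.card {w : W // p • w = 0} ≤ p ^ m) (w : W) : ∃ z : W, (N ^ m) w = p • z := by
  let P : W →ₗ[ℤ] W := p • LinearMap.id
  have hP : ∀ w, P w = p • w := fun w => rfl
  have hQ : ∀ q : W ⧸ LinearMap.range P, p • q = 0 := by
    intro q
    obtain ⟨w, rfl⟩ := Submodule.Quotient.mk_surjective _ q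
    rw [← Submodule.Quotient.mk_smul, Submodule.Quotient.mk_eq_zero]
    exact ⟨w, rfl⟩
  have : Finite (W ⧸ LinearMap.range P) := Quotient.finite _
  have hle : LinearMap.range P ≤ Submodule.comap N (LinearMap.range P) := by
    rintro _ ⟨y, rfl⟩
    exact ⟨N y, by simp [hP]⟩
  let F : Module.End ℤ (W ⧸ LinearMap.range P) := Submodule.mapQ _ _ N hle
  have hFk : ∀ (k : ℕ) (w : W), (F ^ k) (Submodule.Quotient.mk w)
      = Submodule.Quotient.mk ((N ^ k) w) := by
    intro k
    induction k with
    | zero => intro w; rfl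
    | succ k ih =>
      intro w
      rw [pow_succ, pow_succ, Module.End.mul_apply, Module.End.mul_apply, ← ih]
      rfl
  have hcQ : Nat.card (W ⧸ LinearMap.range P) ≤ p ^ m := by
    have c1 := Submodule.card_eq_card_quotient_mul_card (LinearMap.range P)
    have c2 := Submodule.card_eq_card_quotient_mul_card (LinearMap.ker P)
    have c3 := Nat.card_congr (LinearMap.quotKerEquivRange P).toEquiv
    have c4 : Nat.card (LinearMap.ker P) = Nat.card {w : W // p • w = 0} :=
      Nat.card_congr (Equiv.subtypeEquivRight (fun w => by simp [hP]))
    have c5 : 0 < Nat.card (LinearMap.range P) := Nat.card_pos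
    have c6 : Nat.card (W ⧸ LinearMap.range P) = Nat.card (LinearMap.ker P) := by
      rw [c3] at c2
      apply Nat.eq_of_mul_eq_mul_left c5
      rw [← c1, c2, mul_comm]
    rw [c6, c4]; exact hc
  have hFn : IsNilpotent F := by
    obtain ⟨k, hk⟩ := hN
    refine ⟨k, LinearMap.ext fun q => ?_⟩
    obtain ⟨w, rfl⟩ := Submodule.Quotient.mk_surjective _ q
    rw [hFk, hk]; simp
  have hmem := aux_elem p m hp _ hQ F hFn hcQ (Submodule.Quotient.mk w)
  rw [hFk, Submodule.Quotient.mk_eq_zero] at hmem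
  obtain ⟨z, hz⟩ := hmem
  exact ⟨z, hz.symm⟩

open Polynomial in
/-- The main linear-algebra step. -/
theorem aux_unit (p m : ℕ) (hp : p.Prime) (hm : m + 2 ≤ p) (B : Type*) [AddCommGroup B] [Finite B]
    (N : Module.End ℤ B) (hN : IsNilpotent N)
    (hc : Nat.card {w : B // p • w = 0} ≤ p ^ m) (x : B) :
    ∃ U : Module.End ℤ B, IsUnit U ∧ (∑ i ∈ Finset.range p, (N + 1) ^ i) x = p • U x := by
  obtain ⟨h, hh⟩ := aux_poly p hp
  let φ : ℤ[X] →ₗ[ℤ] B := (LinearMap.applyₗ x) ∘ₗ (aeval N : ℤ[X] →ₐ[ℤ] Module.End ℤ B).toLinearMap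
  have hφ : ∀ f, φ f = aeval N f x := fun f => rfl
  let W := LinearMap.range φ
  have hW : ∀ w ∈ W, N w ∈ W := by
    rintro _ ⟨f, rfl⟩
    exact ⟨X * f, by simp [hφ]⟩
  have hxW : x ∈ W := ⟨1, by simp [hφ]⟩
  have hNW : IsNilpotent (N.restrict hW) := by
    obtain ⟨k, hk⟩ := hN
    refine ⟨k, ?_⟩
    rw [Module.End.pow_restrict]
    ext w
    simp [hk]
  have hcW : Nat.card {w : W // p • w = 0} ≤ p ^ m := by
    refine le_trans (Nat.card_le_card_of_injective
      (fun w : {w : W // p • w = 0} => (⟨w.1.1, ?_⟩ : {w : B // p • w = 0})) ?_) hc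
    · have := congrArg Subtype.val w.2
      simpa using this
    · intro a b hab
      apply Subtype.ext
      apply Subtype.ext
      simpa using hab
  obtain ⟨⟨z, f, hf⟩, hz⟩ := aux_nilp p m hp W (N.restrict hW) hNW hcW ⟨x, hxW⟩
  have hz' : (N ^ m) x = p • z := by
    have := congrArg Subtype.val hz
    rw [Module.End.pow_restrict] at this
    simpa using this
  rw [hφ] at hf
  set g : ℤ[X] := h + X ^ (p - 2 - m) * f with hg
  refine ⟨1 + N * aeval N g, ?_, ?_⟩
  · apply IsNilpotent.isUnit_one_add
    apply Commute.isNilpotent_mul_right _ hN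
    have := Commute.map (Commute.all (X : ℤ[X]) g) (aeval N : ℤ[X] →ₐ[ℤ] Module.End ℤ B)
    simpa using this
  · have h1 := congrArg (fun q => aeval N q x) hh
    simp only [map_sum, map_pow, map_add, map_mul, aeval_X, map_one, map_natCast] at h1
    rw [h1]
    have h2 : N ^ (p - 1) = N * (N ^ (p - 2 - m) * N ^ m) := by
      rw [← pow_add, ← pow_succ']; congr 1; omega
    rw [h2, hg]
    simp only [LinearMap.add_apply, Module.End.mul_apply, hz', map_nsmul, map_add, map_mul,
      map_pow, aeval_X, Module.End.natCast_apply, Module.End.one_apply, hf, smul_add]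
    abel

theorem aux_card (p m : ℕ) (hp : p.Prime) (α : Fin m → ℕ) (B : Type*) [AddCommGroup B]
    (e : B ≃+ (∀ i : Fin m, ZMod (p ^ α i))) : Nat.card {w : B // p • w = 0} ≤ p ^ m := by
  classical
  haveI : ∀ i, NeZero (p ^ α i) := fun i => ⟨pow_ne_zero _ hp.ne_zero⟩
  have h1 : Nat.card {w : B // p • w = 0} ≤
      Nat.card (∀ i : Fin m, {a : ZMod (p ^ α i) // p • a = 0}) := by
    refine Nat.card_le_card_of_injective (fun w i => ⟨e w.1 i, ?_⟩) ?_
    · have := congrArg (fun v => e v i) w.2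
      simpa using this
    · intro a b hab
      apply Subtype.ext
      apply e.injective
      funext i
      exact congrArg Subtype.val (congrFun hab i)
  refine h1.trans ?_
  rw [Nat.card_pi]
  refine (Finset.prod_le_pow_card _ _ p ?_).trans (by simp)
  intro i _
  have := IsAddCyclic.card_nsmul_eq_zero_le (α := ZMod (p ^ α i)) hp.pos
  rw [Nat.card_eq_fintype_card, Fintype.card_subtype]
  exact this

theorem aux_isNilpotent (p n e : ℕ) (hp : p.Prime) (R : Type*) [Ring R] (N : R)
    (h1 : (N + 1) ^ p ^ n = 1) (h2 : (p : R) ^ e = 0) : IsNilpotent N := by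
  obtain ⟨r, hr⟩ := Commute.exists_add_pow_prime_pow_eq hp (Commute.one_right N) n
  rw [h1, one_pow, mul_one, mul_assoc] at hr
  have h3 : N ^ p ^ n = (p : R) * -(N * r) := by
    rw [mul_neg]
    apply eq_neg_of_add_eq_zero_left
    have : (1 : R) + 0 = 1 + (N ^ p ^ n + p * (N * r)) := by rw [add_zero]; nth_rw 1 [hr]; abel
    exact (add_left_cancel this).symm
  refine ⟨p ^ n * e, ?_⟩
  rw [pow_mul, h3, (Nat.cast_commute p _).mul_pow, h2, zero_mul]


/-- Let `p` be a prime and `B` a finite left brace with additive group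
isomorphic to `Z/(p^{α₁}) × ⋯ × Z/(p^{α_m})`, `1 ≤ α₁ ≤ ⋯ ≤ α_m`. If `m + 2 ≤ p`, then
for every `x ∈ B` the multiplicative order of `x` equals its additive order. -/
theorem stmt9 (p m : ℕ) (hp : p.Prime) (α : Fin m → ℕ)
    (hα1 : ∀ i, 1 ≤ α i) (hαmono : Monotone α) (hm : m + 2 ≤ p)
    (B : Type*) [AddCommGroup B] [Group B] [Fintype B]
    (brace : ∀ a b c : B, a * (b + c) + a = a * b + a * c)
    (hadd : Nonempty (B ≃+ (∀ i : Fin m, ZMod (p ^ α i)))) :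
    ∀ x : B, orderOf x = addOrderOf x := by
  classical
  obtain ⟨e⟩ := hadd
  have hcard := aux_card p m hp α B e
  have h10 : (1 : B) = 0 := by
    have := brace 1 0 0
    simpa using this
  -- the lambda maps
  let L : B → Module.End ℤ B := fun x =>
    (AddMonoidHom.mk' (fun b => x * b - x) (by
      intro b c
      have := brace x b c
      rw [eq_sub_of_add_eq this]; abel)).toIntLinearMap
  have hL : ∀ x b, L x b = x * b - x := fun x b => rfl
  have hLmul : ∀ x y, L (x * y) = L x * L y := by
    intro x y
    ext b
    rw [Module.End.mul_apply, hL, hL, hL]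
    have := brace x (y * b - y) y
    rw [sub_add_cancel, ← mul_assoc] at this
    rw [eq_sub_of_add_eq this]; abel
  have hL1 : L 1 = 1 := by
    ext b
    rw [hL, h10]
    have : (0 : B) * b = b := by rw [← h10, one_mul]
    rw [this]; simp
  have hLpow : ∀ (x : B) (k : ℕ), L (x ^ k) = L x ^ k := by
    intro x k
    induction k with
    | zero => simp [hL1]
    | succ k ih => rw [pow_succ, pow_succ, hLmul, ih]
  have hsum : ∀ (x : B) (k : ℕ), x ^ k = (∑ i ∈ Finset.range k, L x ^ i) x := by
    intro x k
    induction k with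
    | zero => simp [h10]
    | succ k ih =>
      rw [Finset.sum_range_succ, LinearMap.add_apply, ← ih, ← hLpow, hL, ← pow_succ]
      abel
  haveI : ∀ i, NeZero (p ^ α i) := fun i => ⟨pow_ne_zero _ hp.ne_zero⟩
  have hB : Nat.card B = p ^ (∑ i, α i) := by
    rw [Nat.card_congr e.toEquiv, Nat.card_pi]
    simp [Finset.prod_pow_eq_pow_sum]
  have hBx : ∀ x : B, x ^ (p ^ (∑ i, α i)) = 1 := by
    intro x; rw [← hB]; exact pow_card_eq_one'
  have hBa : ∀ x : B, (p ^ (∑ i, α i)) • x = 0 := by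
    intro x; rw [← hB]; exact card_nsmul_eq_zero'
  have hstep : ∀ x : B, ∃ U : Module.End ℤ B, IsUnit U ∧ x ^ p = p • U x := by
    intro x
    have hN : IsNilpotent (L x - 1) := by
      apply aux_isNilpotent p (∑ i, α i) (∑ i, α i) hp
      · rw [sub_add_cancel, ← hLpow, hBx, hL1]
      · ext b
        rw [← Nat.cast_pow, Module.End.natCast_apply, hBa]; rfl
    obtain ⟨U, hU, h⟩ := aux_unit p m hp hm B (L x - 1) hN hcard x
    refine ⟨U, hU, ?_⟩
    rw [hsum, ← h, sub_add_cancel]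
  have key : ∀ (k : ℕ) (x : B), x ^ p ^ k = 1 ↔ p ^ k • x = 0 := by
    intro k
    induction k with
    | zero => intro x; simp [h10]
    | succ k ih =>
      intro x
      obtain ⟨U, hU, h⟩ := hstep x
      rw [pow_succ', pow_mul, ih, h, smul_smul, ← pow_succ, ← map_nsmul, ← pow_succ']
      have hinj : Function.Injective U := ((Module.End.isUnit_iff U).1 hU).injective
      exact map_eq_zero_iff U hinj
  intro x
  obtain ⟨a, -, ha⟩ := (Nat.dvd_prime_pow hp).1 (orderOf_dvd_of_pow_eq_one (hBx x))
  obtain ⟨b, -, hb⟩ := (Nat.dvd_prime_pow hp).1 (addOrderOf_dvd_of_nsmul_eq_zero (hBa x))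
  apply Nat.dvd_antisymm
  · rw [hb]
    apply orderOf_dvd_of_pow_eq_one
    rw [key, ← hb]; exact addOrderOf_nsmul_eq_zero x
  · rw [ha]
    apply addOrderOf_dvd_of_nsmul_eq_zero
    rw [← key, ← ha]; exact pow_orderOf_eq_one x
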